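/- arXiv:2110.01684 — 3 statements merged into one kernel-verified Lean document; each statement's English description precedes it below -/
import Mathlib

section
/- Let K be an algebraically closed field, n ≥ 1, S = K[x_1,…,x_{n-1}], and M an S-module that is finite-dimensional as a K-vector space. If the cardinality of supp M equals dim_K M, then M is a semisimple S-module; in fact M is isomorphic as an S-module to the direct sum ⊕_{m ∈ supp M} S/m. -/
open DirectSum

set_option synthInstance.maxHeartbeats 1000000
set_option maxHeartbeats 1000000

/-- The support of a module `M` over a commutative ring `S`: the set of maximal ideals `m`
with `mM ≠ M`. -/
def moduleSupp (S : Type*) [CommRing S] (M : Type*) [AddCommGroup M] [Module S M] :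
    Set (Ideal S) :=
  {m : Ideal S | m.IsMaximal ∧ m • (⊤ : Submodule S M) ≠ ⊤}

/-- A module `M` with `mM ≠ M` for a maximal ideal `m` surjects onto the residue field at `m`. -/
theorem exists_surjective_quotient_of_mem_moduleSupp {S M : Type*} [CommRing S] [AddCommGroup M]
    [Module S M] {m : Ideal S} (hm : m ∈ moduleSupp S M) :
    ∃ g : M →ₗ[S] S ⧸ m, Function.Surjective g := by
  obtain ⟨hmax, hne⟩ := hm
  let _ := Ideal.Quotient.field m
  have : Nontrivial (M ⧸ m • (⊤ : Submodule S M)) := Submodule.Quotient.nontrivial_iff.mpr hne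
  obtain ⟨v, hv⟩ := exists_ne (0 : M ⧸ m • (⊤ : Submodule S M))
  obtain ⟨f, hf⟩ : ∃ f : Module.Dual (S ⧸ m) (M ⧸ m • (⊤ : Submodule S M)), f v ≠ 0 := by
    by_contra! hzero
    exact hv ((Module.forall_dual_apply_eq_zero_iff (S ⧸ m) v).mp hzero)
  refine ⟨f.restrictScalars S ∘ₗ Submodule.mkQ _, ?_⟩
  exact (LinearMap.surjective fun h0 => hf (by simp [h0])).comp (Submodule.mkQ_surjective _)

/-- Surjections from `M` onto quotients by finitely many pairwise coprime ideals are jointly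
surjective. -/
theorem surjective_pi_of_pairwise_isCoprime {S M ι : Type*} [CommRing S] [AddCommGroup M]
    [Module S M] [Finite ι] {I : ι → Ideal S} (hI : Pairwise fun i j => IsCoprime (I i) (I j))
    (g : ∀ i, M →ₗ[S] S ⧸ I i) (hg : ∀ i, Function.Surjective (g i)) :
    Function.Surjective (LinearMap.pi g) := by
  classical
  have := Fintype.ofFinite ι
  intro y
  choose x hx using fun i => hg i (y i)
  choose s hs using fun i => Ideal.exists_forall_sub_mem_ideal hI
    (fun j => if j = i then (1 : S) else 0)
  refine ⟨∑ i, s i • x i, funext fun j => ?_⟩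
  have hterm (i : ι) : s i • g j (x i) = if i = j then y j else 0 := by
    have hmk := Ideal.Quotient.eq.mpr (hs i j)
    rw [Algebra.smul_def, Ideal.Quotient.algebraMap_eq, hmk]
    by_cases hij : i = j
    · subst hij
      simp [hx]
    · simp [hij, Ne.symm hij]
  simp [hterm]

/-- If `M` is a module over a `K`-algebra `S` whose support has `dim_K M` elements, then `M` is
the direct sum of the residue fields at its support. -/
theorem nonempty_linearEquiv_directSum_quotient (K : Type*) {S M : Type*} [Field K] [CommRing S]
    [Algebra K S] [AddCommGroup M] [Module K M] [Module S M] [IsScalarTower K S M]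
    [FiniteDimensional K M] (h : (moduleSupp S M).ncard = Module.finrank K M) :
    Nonempty (M ≃ₗ[S] ⨁ m : moduleSupp S M, S ⧸ (m : Ideal S)) := by
  classical
  have hfin : (moduleSupp S M).Finite := by
    by_contra hinf
    rw [Set.Infinite.ncard hinf] at h
    have := Module.finrank_zero_iff.mp h.symm
    obtain ⟨m, -, hm⟩ := Set.Infinite.nonempty hinf
    exact hm (Subsingleton.elim _ _)
  have := hfin.fintype
  choose g hg using fun m : moduleSupp S M => exists_surjective_quotient_of_mem_moduleSupp m.2
  have hcop : Pairwise fun m m' : moduleSupp S M => IsCoprime (m : Ideal S) (m' : Ideal S) := by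
    intro m m' hne
    exact Ideal.isCoprime_iff_sup_eq.mpr
      (m.2.1.coprime_of_ne m'.2.1 (Subtype.coe_injective.ne hne))
  have hsurj := surjective_pi_of_pairwise_isCoprime hcop g hg
  have hfd (m : moduleSupp S M) : FiniteDimensional K (S ⧸ (m : Ideal S)) :=
    Module.Finite.of_surjective ((g m).restrictScalars K) (hg m)
  have hle : Module.finrank K M ≤ Module.finrank K (∀ m : moduleSupp S M, S ⧸ (m : Ideal S)) := by
    rw [Module.finrank_pi_fintype, ← h, ← Nat.card_coe_set_eq, Nat.card_eq_fintype_card,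
      Fintype.card_eq_sum_ones]
    refine Finset.sum_le_sum fun m _ => ?_
    have := m.2.1
    exact Nat.one_le_iff_ne_zero.mpr Module.finrank_pos.ne'
  have heq := hle.antisymm
    (LinearMap.finrank_le_finrank_of_surjective (f := (LinearMap.pi g).restrictScalars K) hsurj)
  have hinj : Function.Injective ((LinearMap.pi g).restrictScalars K) :=
    (LinearMap.injective_iff_surjective_of_finrank_eq_finrank heq).mpr hsurj
  exact ⟨(LinearEquiv.ofBijective (LinearMap.pi g) ⟨hinj, hsurj⟩).trans
    (DirectSum.linearEquivFunOnFintype S _ _).symm⟩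

/-- A direct sum of quotients by maximal ideals is semisimple. -/
theorem isSemisimpleModule_directSum_quotient {S ι : Type*} [CommRing S] {I : ι → Ideal S}
    (hI : ∀ i, (I i).IsMaximal) : IsSemisimpleModule S (⨁ i, S ⧸ I i) := by
  have hsimple (i : ι) : IsSimpleModule S (S ⧸ I i) := isSimpleModule_iff_isCoatom.mpr (hI i).out
  exact inferInstanceAs (IsSemisimpleModule S (Π₀ i, S ⧸ I i))

/-- For `M` a module over `S = K[x_1, …, x_{n-1}]` (with `K` algebraically closed) that is
finite-dimensional over `K`, if `|supp M| = dim_K M` then `M` is semisimple; in fact, `M` is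
isomorphic to the direct sum `⊕_{m ∈ supp M} S ⧸ m`. -/
theorem semisimple_of_supp_card_eq_dim
    (K : Type*) [Field K] [IsAlgClosed K] (n : ℕ) (hn : 1 ≤ n)
    (M : Type*) [AddCommGroup M] [Module K M]
    [Module (MvPolynomial (Fin (n - 1)) K) M]
    [IsScalarTower K (MvPolynomial (Fin (n - 1)) K) M]
    [FiniteDimensional K M]
    (h : (moduleSupp (MvPolynomial (Fin (n - 1)) K) M).ncard = Module.finrank K M) :
    IsSemisimpleModule (MvPolynomial (Fin (n - 1)) K) M ∧
    Nonempty (M ≃ₗ[MvPolynomial (Fin (n - 1)) K]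
      ⨁ m : (moduleSupp (MvPolynomial (Fin (n - 1)) K) M),
        MvPolynomial (Fin (n - 1)) K ⧸ (m : Ideal (MvPolynomial (Fin (n - 1)) K))) := by
  have ⟨e⟩ := nonempty_linearEquiv_directSum_quotient K h
  have := isSemisimpleModule_directSum_quotient
    fun m : moduleSupp (MvPolynomial (Fin (n - 1)) K) M => m.2.1
  exact ⟨.congr e, ⟨e⟩⟩
end

section
/- Let K be an algebraically closed field, n ≥ 1, S = K[x_1,…,x_{n-1}], and M an S-module with dim_K M = n. If the zero polynomial is the only element of √Ann(M) of total degree at most 1 (i.e., √Ann(M) ∩ S_{≤1} = 0), then the number of maximal ideals m of S with mM ≠ M equals n, i.e. |supp M| = dim_K M. -/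
/-- Distinct maximal ideals `m` with `m M ≠ M` number at most `dim_K M`. -/
theorem card_le_finrank_of_isMaximal_of_smul_top_ne_top
    {K S M : Type*} [Field K] [CommRing S] [Algebra K S] [AddCommGroup M] [Module K M]
    [Module S M] [IsScalarTower K S M] [FiniteDimensional K M] (T : Finset (Ideal S))
    (hT : ∀ m ∈ T, m.IsMaximal ∧ m • (⊤ : Submodule S M) ≠ ⊤) :
    T.card ≤ Module.finrank K M := by
  classical
  have hv : ∀ m : T, ∃ v : M, v ∉ m.1 • (⊤ : Submodule S M) := fun m => by
    by_contra! h
    exact (hT m m.2).2 (eq_top_iff.2 fun x _ => h x)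
  choose v hv using hv
  have hcop : Pairwise fun m m' : T => IsCoprime m.1 m'.1 := fun m m' h =>
    Ideal.isCoprime_iff_sup_eq.2
      ((hT m m.2).1.coprime_of_ne (hT m' m'.2).1 fun e => h (Subtype.ext e))
  have he : ∀ m : T, ∃ e : S, ∀ m' : T, e - (if m' = m then 1 else 0) ∈ m'.1 := fun m =>
    Ideal.exists_forall_sub_mem_ideal hcop _
  choose e he using he
  have hother : ∀ m m' : T, m' ≠ m → e m • v m ∈ m'.1 • (⊤ : Submodule S M) := fun m m' h => by
    have := he m m'
    rw [if_neg h, sub_zero] at this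
    exact Submodule.smul_mem_smul this trivial
  have hself : ∀ m : T, e m • v m ∉ m.1 • (⊤ : Submodule S M) := fun m h => by
    have h1 := he m m
    rw [if_pos rfl] at h1
    have h2 : (e m - 1) • v m ∈ m.1 • (⊤ : Submodule S M) := Submodule.smul_mem_smul h1 trivial
    apply hv m
    have h3 := Submodule.sub_mem _ h h2
    rwa [sub_smul, one_smul, sub_sub_cancel] at h3
  have hli : LinearIndependent K fun m : T => e m • v m := by
    rw [Fintype.linearIndependent_iff]
    intro c hc m
    by_contra hne
    apply hself m
    let N : Submodule K M := (m.1 • (⊤ : Submodule S M)).restrictScalars K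
    have hN : c m • e m • v m ∈ N := by
      rw [← Finset.add_sum_erase _ _ (Finset.mem_univ m)] at hc
      rw [eq_neg_of_add_eq_zero_left hc]
      exact N.neg_mem (N.sum_mem fun m' hm' => N.smul_mem _
        (hother m' m (Finset.ne_of_mem_erase hm').symm))
    exact (N.smul_mem_iff hne).1 hN
  simpa using hli.fintype_card_le_finrank

/-- A maximal ideal containing the annihilator of a finite module `M` satisfies `m M ≠ M`. -/
theorem Ideal.smul_top_ne_top_of_annihilator_le {S M : Type*} [CommRing S] [AddCommGroup M]
    [Module S M] [Module.Finite S M] {m : Ideal S} (hm : m ≠ ⊤)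
    (h : Module.annihilator S M ≤ m) : m • (⊤ : Submodule S M) ≠ ⊤ := by
  intro htop
  obtain ⟨r, hr, hr0⟩ := Submodule.exists_sub_one_mem_and_smul_eq_zero_of_fg_of_le_smul m
    (⊤ : Submodule S M) Module.Finite.fg_top htop.ge
  have hrm : r ∈ m := h (Module.mem_annihilator.2 fun x => hr0 x trivial)
  apply hm
  rw [Ideal.eq_top_iff_one]
  simpa using m.sub_mem hrm hr

/-- Fewer than `d + 1` points in affine `d`-space lie on the zero locus of a nonzero polynomial
of degree at most one. -/
theorem MvPolynomial.exists_ne_zero_totalDegree_le_one_eval_eq_zero {K ι : Type*} [Field K]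
    {d : ℕ} [Fintype ι] (x : ι → Fin d → K) (h : Fintype.card ι < d + 1) :
    ∃ f : MvPolynomial (Fin d) K, f ≠ 0 ∧ f.totalDegree ≤ 1 ∧ ∀ i, eval (x i) f = 0 := by
  classical
  let A : K × (Fin d → K) →ₗ[K] ι → K :=
    { toFun := fun c i => c.1 + ∑ j, c.2 j * x i j
      map_add' := fun a b => by
        ext i
        simp only [Prod.fst_add, Prod.snd_add, Pi.add_apply, add_mul, Finset.sum_add_distrib]
        ring
      map_smul' := fun a b => by
        ext i
        simp [mul_add, Finset.mul_sum, mul_assoc] }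
  have hA : LinearMap.ker A ≠ ⊥ := LinearMap.ker_ne_bot_of_finrank_lt (by simpa [add_comm] using h)
  obtain ⟨c, hc, hc0⟩ := (Submodule.ne_bot_iff _).1 hA
  refine ⟨C c.1 + ∑ j, C (c.2 j) * X j, fun h0 => hc0 ?_, ?_, fun i => ?_⟩
  · have h1 : c.1 = 0 := by simpa using congrArg (eval 0) h0
    refine Prod.ext h1 ?_
    ext j
    simpa [h1, Pi.single_apply] using congrArg (eval (Pi.single j 1)) h0
  · refine (totalDegree_add _ _).trans (max_le (by simp) ?_)
    refine totalDegree_finsetSum_le fun j _ => (totalDegree_mul _ _).trans ?_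
    simp
  · simpa [A] using congrFun (LinearMap.mem_ker.1 hc) i


/-- For `M` a module over `S = K[x_1, …, x_{n-1}]` (`K` algebraically closed) with
`dim_K M = n`, if the only polynomial of total degree at most one lying in `√Ann(M)` is zero,
then `|supp M| = n`. -/
theorem supp_card_eq_dim_of_radical_cap_linear_eq_zero
    (K : Type*) [Field K] [IsAlgClosed K] (n : ℕ) (hn : 1 ≤ n)
    (M : Type*) [AddCommGroup M] [Module K M]
    [Module (MvPolynomial (Fin (n - 1)) K) M]
    [IsScalarTower K (MvPolynomial (Fin (n - 1)) K) M]
    [FiniteDimensional K M]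
    (hdim : Module.finrank K M = n)
    (hrad : ∀ f : MvPolynomial (Fin (n - 1)) K,
      f ∈ (Module.annihilator (MvPolynomial (Fin (n - 1)) K) M).radical →
      f.totalDegree ≤ 1 → f = 0) :
    {m : Ideal (MvPolynomial (Fin (n - 1)) K) | m.IsMaximal ∧
        m • (⊤ : Submodule (MvPolynomial (Fin (n - 1)) K) M) ≠ ⊤}.ncard = n := by
  set s := {m : Ideal (MvPolynomial (Fin (n - 1)) K) | m.IsMaximal ∧
    m • (⊤ : Submodule (MvPolynomial (Fin (n - 1)) K) M) ≠ ⊤}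
  have hle (T : Finset (Ideal (MvPolynomial (Fin (n - 1)) K))) (hT : ↑T ⊆ s) : T.card ≤ n :=
    hdim ▸ card_le_finrank_of_isMaximal_of_smul_top_ne_top (K := K) T fun _ hm => hT hm
  have hfin : s.Finite := by
    by_contra hinf
    obtain ⟨T, hT, hcard⟩ := Set.Infinite.exists_subset_card_eq hinf (n + 1)
    have := hle T hT
    lia
  have : Module.Finite (MvPolynomial (Fin (n - 1)) K) M :=
    Module.Finite.of_restrictScalars_finite K _ M
  have : Fintype s := hfin.fintype
  rw [Set.ncard_eq_toFinset_card s hfin]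
  refine le_antisymm (hle _ (by simp)) (not_lt.1 fun hlt => ?_)
  have hpt (m : s) : ∃ x : Fin (n - 1) → K, m.1 = MvPolynomial.vanishingIdeal K {x} :=
    MvPolynomial.isMaximal_iff_eq_vanishingIdeal_singleton.1 m.2.1
  choose x hx using hpt
  obtain ⟨f, hf0, hfdeg, hf⟩ :=
    MvPolynomial.exists_ne_zero_totalDegree_le_one_eval_eq_zero x (by
      rwa [Nat.sub_add_cancel hn, ← Nat.card_eq_fintype_card, Nat.card_coe_set_eq,
        Set.ncard_eq_toFinset_card s hfin])
  refine hf0 (hrad f ?_ hfdeg)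
  rw [Ideal.radical_eq_jacobson, Ideal.jacobson, Submodule.mem_sInf]
  rintro m ⟨hann, hm⟩
  let m' : s := ⟨m, hm, Ideal.smul_top_ne_top_of_annihilator_le hm.ne_top hann⟩
  change f ∈ m'.1
  rw [hx m', MvPolynomial.mem_vanishingIdeal_singleton_iff]
  simpa using hf m'
end

section
/- Let K be an algebraically closed field, n ≥ 1, S = K[x_1,…,x_{n-1}], and M an S-module with dim_K M = n. If M is not a semisimple S-module, then there exists a nonzero polynomial f ∈ S of total degree at most 1 such that f ∈ √Ann(M), i.e. f^r ∈ Ann(M) for some positive integer r. -/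
section Eigenvectors

variable {K A M : Type*} [Field K] [CommRing A] [Algebra K A] [AddCommGroup M]
  [Module K M] [Module A M] [IsScalarTower K A M]

/-- Joint eigenvectors with pairwise distinct characters are linearly independent. -/
theorem linearIndependent_of_smul_eq_algHom_smul {ι : Type*} {χ : ι → A →ₐ[K] K}
    (hχ : Function.Injective χ) {v : ι → M} (hv0 : ∀ i, v i ≠ 0)
    (hv : ∀ i a, a • v i = χ i a • v i) : LinearIndependent K v := by
  rw [linearIndependent_iff']
  intro s c hc i hi
  have hli : LinearIndependent K fun j => (⇑(χ j : A →* K) : A → K) :=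
    (linearIndependent_monoidHom A K).comp (fun j => (χ j : A →* K)) fun j k hjk =>
      hχ (AlgHom.ext fun a => DFunLike.congr_fun hjk a)
  have hφ : ∀ φ : Module.Dual K M, φ (c i • v i) = 0 := by
    intro φ
    refine linearIndependent_iff'.1 hli s (fun j => φ (c j • v j)) ?_ i hi
    ext a
    have h := congrArg (fun m => φ (a • m)) hc
    simp only [Finset.smul_sum, smul_zero, map_zero, map_sum] at h
    simp only [Finset.sum_apply, Pi.smul_apply, Pi.zero_apply]
    rw [← h]
    refine Finset.sum_congr rfl fun j _ => ?_
    have hj : a • c j • v j = c j • χ j a • v j := by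
      rw [← hv j a, ← algebraMap_smul A (c j) (v j), ← algebraMap_smul A (c j) (a • v j),
        smul_comm]
    simp only [hj, map_smul, smul_eq_mul, MonoidHom.coe_coe]
    ring
  exact (smul_eq_zero.1 ((Module.forall_dual_apply_eq_zero_iff K _).1 hφ)).resolve_right (hv0 i)

/-- A joint eigenvector spans a simple submodule. -/
theorem isSimpleModule_span_singleton_of_smul_eq_algHom_smul {χ : A →ₐ[K] K} {v : M}
    (hv0 : v ≠ 0) (hv : ∀ a, a • v = χ a • v) :
    IsSimpleModule A (Submodule.span A {v}) := by
  rw [isSimpleModule_iff_isAtom]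
  refine ⟨by simpa using hv0, fun N hN => ?_⟩
  by_contra hne
  obtain ⟨w, hw, hw0⟩ := N.ne_bot_iff.1 hne
  obtain ⟨a, rfl⟩ := Submodule.mem_span_singleton.1 (hN.le hw)
  have ha : χ a ≠ 0 := by
    intro h
    simp [hv a, h] at hw0
  refine hN.not_ge ((Submodule.span_singleton_le_iff_mem _ _).2 ?_)
  have h := N.smul_mem (algebraMap K A (χ a)⁻¹) hw
  rwa [← algebra_compatible_smul, hv a, smul_smul, inv_mul_cancel₀ ha, one_smul] at h

/-- If the joint eigenvectors of a family span `M` over `K`, then `M` is semisimple. -/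
theorem isSemisimpleModule_of_span_eigenvectors_eq_top {ι : Type*} {χ : ι → A →ₐ[K] K}
    {v : ι → M} (hv0 : ∀ i, v i ≠ 0) (hv : ∀ i a, a • v i = χ i a • v i)
    (hspan : Submodule.span K (Set.range v) = ⊤) : IsSemisimpleModule A M := by
  have hsimple := fun i => isSimpleModule_span_singleton_of_smul_eq_algHom_smul (hv0 i) (hv i)
  refine isSemisimpleModule_of_isSemisimpleModule_submodule'
    (p := fun i => Submodule.span A {v i}) (fun i => inferInstance) ?_
  rw [← Submodule.span_range_eq_iSup, eq_top_iff]
  intro m _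
  exact Submodule.span_le_restrictScalars K A _ (hspan ▸ Submodule.mem_top : m ∈ _)

/-- Over an algebraically closed field, every associated prime of a finite-dimensional module is
the kernel of the character of a joint eigenvector. -/
theorem exists_algHom_eigenvector_of_mem_associatedPrimes [IsAlgClosed K] [IsNoetherianRing A]
    [FiniteDimensional K M] {p : Ideal A} (hp : p ∈ associatedPrimes A M) :
    ∃ (χ : A →ₐ[K] K) (v : M), v ≠ 0 ∧ (∀ a, a • v = χ a • v) ∧ ∀ a, a ∈ p ↔ χ a = 0 := by
  obtain ⟨hprime, v, hpv⟩ := isAssociatedPrime_iff.1 hp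
  have hmem : ∀ a, a ∈ p ↔ a • v = 0 := fun a => by simp [hpv, Submodule.mem_colon_singleton]
  have hv0 : v ≠ 0 := by
    rintro rfl
    exact hprime.ne_top (Ideal.eq_top_iff_one _ |>.2 ((hmem 1).2 (smul_zero _)))
  let g : (A ⧸ p) →ₗ[K] M := (Submodule.liftQ p (LinearMap.toSpanSingleton A M v)
    fun a ha => (hmem a).1 ha).restrictScalars K
  have hg : Function.Injective g := by
    rw [injective_iff_map_eq_zero]
    intro x hx
    obtain ⟨a, rfl⟩ := Ideal.Quotient.mk_surjective x
    exact Ideal.Quotient.eq_zero_iff_mem.2 ((hmem a).2 hx)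
  have : FiniteDimensional K (A ⧸ p) := FiniteDimensional.of_injective g hg
  let e : K ≃ₐ[K] A ⧸ p := AlgEquiv.ofBijective (Algebra.ofId K (A ⧸ p))
    IsAlgClosed.algebraMap_bijective_of_isIntegral
  let χ : A →ₐ[K] K := (e.symm : (A ⧸ p) →ₐ[K] K).comp (Ideal.Quotient.mkₐ K p)
  have hχ : ∀ a, a ∈ p ↔ χ a = 0 := fun a => by
    simp [χ, Ideal.Quotient.eq_zero_iff_mem]
  refine ⟨χ, v, hv0, fun a => ?_, hχ⟩
  have h : (a - algebraMap K A (χ a)) • v = 0 := by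
    rw [← hmem, hχ, map_sub, AlgHom.commutes]
    exact sub_self _
  rwa [sub_smul, ← algebra_compatible_smul, sub_eq_zero] at h

end Eigenvectors

/-- Fewer than `card σ + 1` linear functionals on polynomials have a common zero among the nonzero
polynomials of degree at most one. -/
theorem MvPolynomial.exists_ne_zero_totalDegree_le_one_forall_eq_zero {K σ ι : Type*} [Field K]
    [Fintype σ] [Fintype ι] (φ : ι → MvPolynomial σ K →ₗ[K] K)
    (h : Fintype.card ι < Fintype.card σ + 1) :
    ∃ f : MvPolynomial σ K, f ≠ 0 ∧ f.totalDegree ≤ 1 ∧ ∀ i, φ i f = 0 := by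
  classical
  let L : K × (σ → K) →ₗ[K] MvPolynomial σ K :=
    LinearMap.coprod (Algebra.linearMap K _) (Fintype.linearCombination K MvPolynomial.X)
  have hL : ∀ x, L x = C x.1 + ∑ i, C (x.2 i) * X i := fun x => by
    simp [L, Fintype.linearCombination_apply, MvPolynomial.smul_eq_C_mul,
      MvPolynomial.algebraMap_eq]
  have hker : LinearMap.ker ((LinearMap.pi φ).comp L) ≠ ⊥ := by
    apply LinearMap.ker_ne_bot_of_finrank_lt
    simpa [add_comm] using h
  obtain ⟨x, hx, hx0⟩ := (Submodule.ne_bot_iff _).1 hker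
  refine ⟨L x, fun h0 => hx0 ?_, ?_, fun i => congrFun hx i⟩
  · rw [hL] at h0
    have h1 : x.1 = 0 := by
      simpa using congrArg (MvPolynomial.eval (0 : σ → K)) h0
    refine Prod.ext h1 ?_
    ext i
    simpa [h1, Pi.single_apply] using congrArg (MvPolynomial.eval (Pi.single i (1 : K))) h0
  · rw [hL]
    refine (totalDegree_add _ _).trans (max_le (by simp) ?_)
    refine totalDegree_finsetSum_le fun i _ => ?_
    exact (totalDegree_mul _ _).trans (by simp)

/-- For `M` a module over `S = K[x_1, …, x_{n-1}]` (`K` algebraically closed) with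
`dim_K M = n`, if `M` is not semisimple then there is a nonzero polynomial of total degree at
most one some power of which annihilates `M`. -/
theorem exists_linear_in_radical_annihilator_of_not_semisimple
    (K : Type*) [Field K] [IsAlgClosed K] (n : ℕ) (hn : 1 ≤ n)
    (M : Type*) [AddCommGroup M] [Module K M]
    [Module (MvPolynomial (Fin (n - 1)) K) M]
    [IsScalarTower K (MvPolynomial (Fin (n - 1)) K) M]
    [FiniteDimensional K M]
    (hdim : Module.finrank K M = n)
    (hss : ¬ IsSemisimpleModule (MvPolynomial (Fin (n - 1)) K) M) :
    ∃ f : MvPolynomial (Fin (n - 1)) K, f ≠ 0 ∧ f.totalDegree ≤ 1 ∧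
      ∃ r : ℕ, 0 < r ∧ f ^ r ∈ Module.annihilator (MvPolynomial (Fin (n - 1)) K) M := by
  set S := MvPolynomial (Fin (n - 1)) K
  have : Module.Finite S M := Module.Finite.of_restrictScalars_finite K S M
  choose χ v hv0 hv hχ using fun p : associatedPrimes S M =>
    exists_algHom_eigenvector_of_mem_associatedPrimes (K := K) p.2
  have hinj : Function.Injective χ := fun p q hpq =>
    Subtype.ext (Ideal.ext fun a => by rw [hχ p, hχ q, hpq])
  have hli := linearIndependent_of_smul_eq_algHom_smul hinj hv0 hv
  have : Fintype (associatedPrimes S M) := have := hli.finite; Fintype.ofFinite _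
  have hcard : Fintype.card (associatedPrimes S M) < n := by
    refine lt_of_le_of_ne (hdim ▸ hli.fintype_card_le_finrank) fun h => hss ?_
    exact isSemisimpleModule_of_span_eigenvectors_eq_top hv0 hv
      (hli.span_eq_top_of_card_eq_finrank' (h.trans hdim.symm))
  obtain ⟨f, hf0, hf1, hf⟩ :=
    MvPolynomial.exists_ne_zero_totalDegree_le_one_forall_eq_zero
      (fun p => (χ p).toLinearMap) (by rw [Fintype.card_fin]; omega)
  refine ⟨f, hf0, hf1, ?_⟩
  have hrad : f ∈ (Module.annihilator S M).radical := by
    rw [← Ideal.sInf_minimalPrimes, Ideal.mem_sInf]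
    intro p hp
    exact (hχ ⟨p, Module.associatedPrimes.minimalPrimes_annihilator_subset_associatedPrimes S M hp⟩ f).2 (hf _)
  obtain ⟨r, hr⟩ := hrad
  exact ⟨r + 1, r.succ_pos, by rw [pow_succ]; exact Ideal.mul_mem_right _ _ hr⟩
end
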